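/- A lightcone framed curve (γ,ℓ⁺,ℓ⁻) : I → ℝ³₁ × Δ₄ with lightcone curvature (κ₁,κ₂,κ₃,α,β) is an (ℓ⁻,ℓ̄⁻)-Bertrand lightcone framed curve if and only if there exist smooth functions λ, k : I → ℝ with λ ≢ 0 such that k(t)α(t) = λ(t)κ₂(t) for all t ∈ I; consequently, (γ,ℓ⁺,ℓ⁻) is an (ℓ⁻,ℓ̄⁺)-Bertrand lightcone framed curve if and only if it is an (ℓ⁻,ℓ̄⁻)-Bertrand lightcone framed curve. -/

import Mathlib

open Matrix

noncomputable section

/-- The Minkowski pseudo-scalar product on `ℝ³`: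
`⟨x,y⟩ = −x₁y₁ + x₂y₂ + x₃y₃`. -/
def mdot (x y : Fin 3 → ℝ) : ℝ := -(x 0 * y 0) + x 1 * y 1 + x 2 * y 2

/-- The pseudo vector product `x ∧ y` on Minkowski `ℝ³`, i.e. the determinant of the
matrix with rows `(−e₁, e₂, e₃)`, `x`, `y`. -/
def mcross (x y : Fin 3 → ℝ) : Fin 3 → ℝ :=
  ![-(x 1 * y 2 - x 2 * y 1), x 2 * y 0 - x 0 * y 2, x 0 * y 1 - x 1 * y 0]

/-- The (punctured) lightcone `LC* = {x ≠ 0 : ⟨x,x⟩ = 0}`. -/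
def LCstar (x : Fin 3 → ℝ) : Prop := x ≠ 0 ∧ mdot x x = 0

/-- Membership in `Δ₄ = {(v,w) ∈ LC* × LC* : ⟨v,w⟩ = −2}`. -/
def MemDelta4 (v w : Fin 3 → ℝ) : Prop := LCstar v ∧ LCstar w ∧ mdot v w = -2

/-- `n(t) = −(1/2) ℓ⁺(t) ∧ ℓ⁻(t)`. -/
def lcn (lp lm : ℝ → Fin 3 → ℝ) : ℝ → Fin 3 → ℝ :=
  fun t => (-(1/2) : ℝ) • mcross (lp t) (lm t)

/-- Smoothness (on `I`) of a real valued function. -/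
def Smooth1 (I : Set ℝ) (f : ℝ → ℝ) : Prop := ContDiffOn ℝ (⊤ : ℕ∞) f I

/-- Smoothness (on `I`) of an `ℝ³`-valued function. -/
def Smooth3 (I : Set ℝ) (f : ℝ → Fin 3 → ℝ) : Prop := ContDiffOn ℝ (⊤ : ℕ∞) f I

/-- `λ ≢ 0` : the set where `λ` is non-zero is dense in `I`. -/
def NotIdentZero (I : Set ℝ) (f : ℝ → ℝ) : Prop :=
  I ⊆ closure {t | t ∈ I ∧ f t ≠ 0}

/-- A lightcone framed curve `(γ, ℓ⁺, ℓ⁻) : I → ℝ³₁ × Δ₄`. -/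
structure IsLightconeFramedCurve (I : Set ℝ) (γ lp lm : ℝ → Fin 3 → ℝ) : Prop where
  smooth_base : Smooth3 I γ
  smooth_lp : Smooth3 I lp
  smooth_lm : Smooth3 I lm
  delta4 : ∀ t ∈ I, MemDelta4 (lp t) (lm t)
  exists_coeffs : ∃ α β : ℝ → ℝ, Smooth1 I α ∧ Smooth1 I β ∧
    ∀ t ∈ I, deriv γ t = α t • lp t + β t • lm t

/-- `(κ₁, κ₂, κ₃, α, β)` is the lightcone curvature of the lightcone framed curve
`(γ, ℓ⁺, ℓ⁻)`. -/
structure HasLightconeCurvature (I : Set ℝ) (γ lp lm : ℝ → Fin 3 → ℝ)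
    (κ₁ κ₂ κ₃ α β : ℝ → ℝ) : Prop where
  smooth_κ₁ : Smooth1 I κ₁
  smooth_κ₂ : Smooth1 I κ₂
  smooth_κ₃ : Smooth1 I κ₃
  smooth_α : Smooth1 I α
  smooth_β : Smooth1 I β
  deriv_lp : ∀ t ∈ I, deriv lp t = κ₁ t • lp t + (2 * κ₃ t) • lcn lp lm t
  deriv_lm : ∀ t ∈ I, deriv lm t = (-κ₁ t) • lm t + (2 * κ₂ t) • lcn lp lm t
  deriv_n : ∀ t ∈ I, deriv (lcn lp lm) t = κ₂ t • lp t + κ₃ t • lm t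
  deriv_base : ∀ t ∈ I, deriv γ t = α t • lp t + β t • lm t

/-- The vector field `ℓ⁺` built from a lightcone frame. -/
def fieldLp (lp lm : ℝ → Fin 3 → ℝ) : ℝ → Fin 3 → ℝ := fun t => lp t
/-- The vector field `ℓ⁻` built from a lightcone frame. -/
def fieldLm (lp lm : ℝ → Fin 3 → ℝ) : ℝ → Fin 3 → ℝ := fun t => lm t
/-- `nᵀ = (ℓ⁺ + ℓ⁻)/2`. -/
def fieldNT (lp lm : ℝ → Fin 3 → ℝ) : ℝ → Fin 3 → ℝ := fun t => (1/2 : ℝ) • (lp t + lm t)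
/-- `nˢ = (ℓ⁺ − ℓ⁻)/2`. -/
def fieldNS (lp lm : ℝ → Fin 3 → ℝ) : ℝ → Fin 3 → ℝ := fun t => (1/2 : ℝ) • (lp t - lm t)
/-- `n = −(1/2) ℓ⁺ ∧ ℓ⁻`. -/
def fieldN (lp lm : ℝ → Fin 3 → ℝ) : ℝ → Fin 3 → ℝ := lcn lp lm
/-- `ℓ̃⁺ = nᵀ + n`. -/
def fieldLtp (lp lm : ℝ → Fin 3 → ℝ) : ℝ → Fin 3 → ℝ :=
  fun t => fieldNT lp lm t + fieldN lp lm t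
/-- `ℓ̃⁻ = nᵀ − n`. -/
def fieldLtm (lp lm : ℝ → Fin 3 → ℝ) : ℝ → Fin 3 → ℝ :=
  fun t => fieldNT lp lm t - fieldN lp lm t

/-- `(γ,ℓ⁺,ℓ⁻)` and `(γ̄,ℓ̄⁺,ℓ̄⁻)` are `(v,w̄)`-mates. -/
def AreMates (I : Set ℝ)
    (v w : (ℝ → Fin 3 → ℝ) → (ℝ → Fin 3 → ℝ) → ℝ → Fin 3 → ℝ)
    (γ lp lm γ' lp' lm' : ℝ → Fin 3 → ℝ) : Prop :=
  IsLightconeFramedCurve I γ lp lm ∧ IsLightconeFramedCurve I γ' lp' lm' ∧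
  ∃ lam : ℝ → ℝ, Smooth1 I lam ∧ NotIdentZero I lam ∧
    (∀ t ∈ I, γ' t = γ t + lam t • v lp lm t) ∧
    (∀ t ∈ I, v lp lm t = w lp' lm' t)

/-- `(γ,ℓ⁺,ℓ⁻)` is a `(v,w̄)`-Bertrand lightcone framed curve. -/
def IsBertrand (I : Set ℝ)
    (v w : (ℝ → Fin 3 → ℝ) → (ℝ → Fin 3 → ℝ) → ℝ → Fin 3 → ℝ)
    (γ lp lm : ℝ → Fin 3 → ℝ) : Prop :=
  ∃ γ' lp' lm' : ℝ → Fin 3 → ℝ, AreMates I v w γ lp lm γ' lp' lm'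

lemma mdot_comm (x y : Fin 3 → ℝ) : mdot x y = mdot y x := by
  simp only [mdot]; ring

lemma mdot_add_left (x y z : Fin 3 → ℝ) : mdot (x + y) z = mdot x z + mdot y z := by
  simp only [mdot, Pi.add_apply]; ring

lemma mdot_smul_left (c : ℝ) (x y : Fin 3 → ℝ) : mdot (c • x) y = c * mdot x y := by
  simp only [mdot, Pi.smul_apply, smul_eq_mul]; ring

lemma mdot_add_right (x y z : Fin 3 → ℝ) : mdot x (y + z) = mdot x y + mdot x z := by
  simp only [mdot, Pi.add_apply]; ring

lemma mdot_smul_right (c : ℝ) (x y : Fin 3 → ℝ) : mdot x (c • y) = c * mdot x y := by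
  simp only [mdot, Pi.smul_apply, smul_eq_mul]; ring

lemma mdot_lcn_left (lp lm : ℝ → Fin 3 → ℝ) (t : ℝ) : mdot (lp t) (lcn lp lm t) = 0 := by
  simp [mdot, lcn, mcross]; ring

lemma mdot_lcn_right (lp lm : ℝ → Fin 3 → ℝ) (t : ℝ) : mdot (lm t) (lcn lp lm t) = 0 := by
  simp [mdot, lcn, mcross]; ring

lemma mdot_mcross_self (x y : Fin 3 → ℝ) :
    mdot (mcross x y) (mcross x y) = mdot x y ^ 2 - mdot x x * mdot y y := by
  simp [mdot, mcross]; ring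

lemma MemDelta4.mdot_lcn_self {lp lm : ℝ → Fin 3 → ℝ} {t : ℝ} (h : MemDelta4 (lp t) (lm t)) :
    mdot (lcn lp lm t) (lcn lp lm t) = 1 := by
  obtain ⟨⟨-, hp⟩, -, hpm⟩ := h
  rw [lcn, mdot_smul_left, mdot_smul_right, mdot_mcross_self, hp, hpm]
  norm_num

lemma MemDelta4.symm {v w : Fin 3 → ℝ} (h : MemDelta4 v w) : MemDelta4 w v :=
  ⟨h.2.1, h.1, by rw [mdot_comm, h.2.2]⟩

lemma IsLightconeFramedCurve.swap {I : Set ℝ} {γ lp lm : ℝ → Fin 3 → ℝ}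
    (h : IsLightconeFramedCurve I γ lp lm) : IsLightconeFramedCurve I γ lm lp := by
  obtain ⟨α, β, hα, hβ, hd⟩ := h.exists_coeffs
  exact ⟨h.smooth_base, h.smooth_lm, h.smooth_lp, fun t ht => (h.delta4 t ht).symm,
    β, α, hβ, hα, fun t ht => by rw [hd t ht, add_comm]⟩

lemma Smooth3.mdot {I : Set ℝ} {f g : ℝ → Fin 3 → ℝ} (hf : Smooth3 I f) (hg : Smooth3 I g) :
    Smooth1 I (fun t => mdot (f t) (g t)) := by
  have hf' := contDiffOn_pi.1 hf
  have hg' := contDiffOn_pi.1 hg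
  exact ((((hf' 0).mul (hg' 0)).neg).add ((hf' 1).mul (hg' 1))).add ((hf' 2).mul (hg' 2))

lemma Smooth3.lcn {I : Set ℝ} {lp lm : ℝ → Fin 3 → ℝ} (hp : Smooth3 I lp) (hm : Smooth3 I lm) :
    Smooth3 I (lcn lp lm) := by
  have hp' := contDiffOn_pi.1 hp
  have hm' := contDiffOn_pi.1 hm
  have h : Smooth3 I (fun t => mcross (lp t) (lm t)) := by
    refine contDiffOn_pi.2 fun i => ?_
    fin_cases i
    · exact (((hp' 1).mul (hm' 2)).sub ((hp' 2).mul (hm' 1))).neg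
    · exact ((hp' 2).mul (hm' 0)).sub ((hp' 0).mul (hm' 2))
    · exact ((hp' 0).mul (hm' 1)).sub ((hp' 1).mul (hm' 0))
  exact ContDiffOn.const_smul (-(1 / 2) : ℝ) h

lemma HasLightconeCurvature.deriv_add_smul_lm {I : Set ℝ} (hIo : IsOpen I)
    {γ lp lm γ' : ℝ → Fin 3 → ℝ} {κ₁ κ₂ κ₃ α β lam : ℝ → ℝ}
    (hF : IsLightconeFramedCurve I γ lp lm) (hC : HasLightconeCurvature I γ lp lm κ₁ κ₂ κ₃ α β)
    (hlam : Smooth1 I lam) (hγ' : ∀ t ∈ I, γ' t = γ t + lam t • lm t) {t : ℝ} (ht : t ∈ I) :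
    deriv γ' t = α t • lp t + (β t + deriv lam t - lam t * κ₁ t) • lm t +
      (2 * (lam t * κ₂ t)) • lcn lp lm t := by
  have hI : I ∈ nhds t := hIo.mem_nhds ht
  have hγd : DifferentiableAt ℝ γ t := (hF.smooth_base.contDiffAt hI).differentiableAt (by simp)
  have hmd : DifferentiableAt ℝ lm t := (hF.smooth_lm.contDiffAt hI).differentiableAt (by simp)
  have hld : DifferentiableAt ℝ lam t := (hlam.contDiffAt hI).differentiableAt (by simp)
  have heq : γ' =ᶠ[nhds t] fun s => γ s + lam s • lm s := by
    filter_upwards [hI] with s hs using hγ' s hs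
  have hd := hγd.hasDerivAt.add (hld.hasDerivAt.smul hmd.hasDerivAt)
  have h : deriv γ' t = deriv γ t + (lam t • deriv lm t + deriv lam t • lm t) :=
    heq.deriv_eq.trans hd.deriv
  rw [h, hC.deriv_base t ht, hC.deriv_lm t ht]
  module

lemma isBertrand_lm_lp_iff {I : Set ℝ} {γ lp lm : ℝ → Fin 3 → ℝ} :
    IsBertrand I fieldLm fieldLp γ lp lm ↔ IsBertrand I fieldLm fieldLm γ lp lm := by
  constructor <;>
  · rintro ⟨γ', lp', lm', hF, hF', h⟩
    exact ⟨γ', lm', lp', hF, hF'.swap, h⟩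

lemma memDelta4_add_smul {lp lm : ℝ → Fin 3 → ℝ} {t : ℝ} (h : MemDelta4 (lp t) (lm t)) (k : ℝ) :
    MemDelta4 (lp t + k ^ 2 • lm t + (2 * k) • lcn lp lm t) (lm t) := by
  have hnn := h.mdot_lcn_self
  have hpn := mdot_lcn_left lp lm t
  have hmn := mdot_lcn_right lp lm t
  have hnp := hpn
  have hnm := hmn
  rw [mdot_comm] at hnp hnm
  obtain ⟨⟨-, hpp⟩, hm, hpm⟩ := h
  have hmp := hpm
  rw [mdot_comm] at hmp
  have hdot : mdot (lp t + k ^ 2 • lm t + (2 * k) • lcn lp lm t) (lm t) = -2 := by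
    simp only [mdot_add_left, mdot_smul_left, hpm, hm.2, hnm]
    ring
  refine ⟨⟨fun h0 => ?_, ?_⟩, hm, hdot⟩
  · rw [h0] at hdot
    simp [mdot] at hdot
  · simp only [mdot_add_left, mdot_smul_left, mdot_add_right, mdot_smul_right, hpp, hm.2, hnn,
      hpm, hmp, hpn, hnp, hmn, hnm]
    ring

/-- `(ℓ⁻,ℓ̄⁻)`-Bertrand lightcone framed curves: existence condition, and equivalence with
the `(ℓ⁻,ℓ̄⁺)`-Bertrand condition. -/
theorem bertrand_lm_lmbar
    (I : Set ℝ) (hIo : IsOpen I) (hIc : I.OrdConnected)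
    (γ lp lm : ℝ → Fin 3 → ℝ) (κ₁ κ₂ κ₃ α β : ℝ → ℝ)
    (hF : IsLightconeFramedCurve I γ lp lm)
    (hC : HasLightconeCurvature I γ lp lm κ₁ κ₂ κ₃ α β) :
    (IsBertrand I fieldLm fieldLm γ lp lm ↔
      ∃ lam k : ℝ → ℝ, Smooth1 I lam ∧ Smooth1 I k ∧ NotIdentZero I lam ∧
        ∀ t ∈ I, k t * α t = lam t * κ₂ t) ∧
    (IsBertrand I fieldLm fieldLp γ lp lm ↔ IsBertrand I fieldLm fieldLm γ lp lm) := by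
  refine ⟨⟨?_, ?_⟩, isBertrand_lm_lp_iff⟩
  · rintro ⟨γ', lp', lm', -, hF', lam, hlam, hlam0, hγ', hlm⟩
    obtain ⟨α', β', -, -, hd'⟩ := hF'.exists_coeffs
    refine ⟨lam, fun t => 1 / 2 * mdot (lp' t) (lcn lp lm t), hlam,
      contDiffOn_const.mul (hF'.smooth_lp.mdot (hF.smooth_lp.lcn hF.smooth_lm)), hlam0, ?_⟩
    intro t ht
    have hlm' : lm' t = lm t := (hlm t ht).symm
    have h := (hC.deriv_add_smul_lm hIo hF hlam hγ' ht).symm.trans (hd' t ht)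
    rw [hlm'] at h
    have hΔ := hF.delta4 t ht
    have hΔ' := hF'.delta4 t ht
    rw [hlm'] at hΔ'
    have h₁ := congrArg (fun v => mdot v (lm t)) h
    have h₂ := congrArg (fun v => mdot v (lcn lp lm t)) h
    simp only [mdot_add_left, mdot_smul_left, hΔ.2.2, hΔ'.2.2, hΔ.2.1.2,
      mdot_comm (lcn lp lm t) (lm t), mdot_lcn_right, mdot_lcn_left, hΔ.mdot_lcn_self] at h₁ h₂
    have hα : α t = α' t := by linarith
    rw [hα]
    linarith
  · rintro ⟨lam, k, hlam, hk, hlam0, hkα⟩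
    have hsm : Smooth3 I (fun t => γ t + lam t • lm t) :=
      hF.smooth_base.add (hlam.smul hF.smooth_lm)
    refine ⟨fun t => γ t + lam t • lm t,
      fun t => lp t + k t ^ 2 • lm t + (2 * k t) • lcn lp lm t, lm, hF,
      ⟨hsm, ?_, hF.smooth_lm, fun t ht => memDelta4_add_smul (hF.delta4 t ht) (k t),
        α, fun t => β t + deriv lam t - lam t * κ₁ t - α t * k t ^ 2, hC.smooth_α, ?_, ?_⟩,
      lam, hlam, hlam0, fun _ _ => rfl, fun _ _ => rfl⟩
    · exact (hF.smooth_lp.add ((hk.pow 2).smul hF.smooth_lm)).add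
        ((contDiffOn_const.mul hk).smul (hF.smooth_lp.lcn hF.smooth_lm))
    · have hdlam : Smooth1 I (deriv lam) := hlam.deriv_of_isOpen hIo (by simp)
      exact ((hC.smooth_β.add hdlam).sub (hlam.mul hC.smooth_κ₁)).sub
        (hC.smooth_α.mul (hk.pow 2))
    · intro t ht
      rw [hC.deriv_add_smul_lm hIo hF hlam (fun _ _ => rfl) ht, ← hkα t ht]
      module
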